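/- arXiv:0907.0620 — 2 statements merged into one kernel-verified Lean document; each statement's English description precedes it below -/
import Mathlib

section
/- Let U = (U_i)_{i≥0} be a positional numeration system satisfying lim_{i→∞}(U_{i+1} − U_i) = +∞ and lim_{m→∞} N_U(m) = +∞. Then the minimal period of any ultimately periodic set X ⊆ ℕ such that rep_U(X) is accepted by a deterministic finite automaton with d states is bounded by the smallest integer s_0 such that N_U(m) > d for all m ≥ s_0. -/
open Filter

/-- `C_U = sup_{i ≥ 0} ⌈U_{i+1} / U_i⌉` (with the ceiling of the quotient of
naturals written as `(U (i+1) + U i - 1) / U i`). -/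
noncomputable def CU (U : ℕ → ℕ) : ℕ :=
  sSup {c : ℕ | ∃ i, c = (U (i + 1) + U i - 1) / U i}

/-- The `U`-numerical value of the word `w = w_ℓ ⋯ w_0` (most significant digit
first): `val_U(w) = Σ_{i=0}^{ℓ} w_i U_i`. -/
def valU (U : ℕ → ℕ) (w : List ℕ) : ℕ :=
  ∑ i ∈ Finset.range w.length, w.reverse.getD i 0 * U i

/-- `w` is the greedy `U`-representation of `n` (most significant digit first):
its digits lie in `A_U = {0, …, C_U - 1}`, its leading digit is nonzero, its
`U`-numerical value is `n`, and `Σ_{i=0}^{t} w_i U_i < U_{t+1}` for all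
`t = 0, …, ℓ`.  In particular `IsGreedyRep U 0 []`. -/
def IsGreedyRep (U : ℕ → ℕ) (n : ℕ) (w : List ℕ) : Prop :=
  valU U w = n ∧
  (∀ d ∈ w, d < CU U) ∧
  (∀ h : w ≠ [], w.head h ≠ 0) ∧
  ∀ t < w.length, ∑ i ∈ Finset.range (t + 1), w.reverse.getD i 0 * U i < U (t + 1)

/-- The language `rep_U(X)` of greedy `U`-representations of the elements of `X`. -/
def repLang (U : ℕ → ℕ) (X : Set ℕ) : Language ℕ :=
  {w | ∃ n ∈ X, IsGreedyRep U n w}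

/-- `X` is periodic with period `p` from index `a` on. -/
def IsPeriodPair (X : Set ℕ) (a p : ℕ) : Prop :=
  0 < p ∧ ∀ n, a ≤ n → (n ∈ X ↔ n + p ∈ X)

/-- `X` is ultimately periodic. -/
def UltPeriodic (X : Set ℕ) : Prop := ∃ a p, IsPeriodPair X a p

/-- The minimal period `p_X` of an ultimately periodic set. -/
noncomputable def minPeriod (X : Set ℕ) : ℕ := sInf {p | ∃ a, IsPeriodPair X a p}

/-- The minimal preperiod `a_X` of an ultimately periodic set. -/
noncomputable def minPreperiod (X : Set ℕ) : ℕ :=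
  sInf {a | IsPeriodPair X a (minPeriod X)}

/-- `N_U(m)`: the number of residues mod `m` taken infinitely often by the
sequence `(U_i mod m)_{i ≥ 0}`. -/
noncomputable def Ninf (s : ℕ → ℕ) (m : ℕ) : ℕ :=
  Set.ncard {r : ZMod m | ∀ N : ℕ, ∃ i, N ≤ i ∧ (s i : ZMod m) = r}


/-- Greedy words, leading zeros allowed. -/
def GreedyWord (U : ℕ → ℕ) (w : List ℕ) : Prop :=
  (∀ d ∈ w, d < CU U) ∧ valU U w < U w.length ∧
  ∀ t < w.length, ∑ i ∈ Finset.range (t + 1), w.reverse.getD i 0 * U i < U (t + 1)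

theorem sum_cons_aux (U : ℕ → ℕ) (q : ℕ) (w : List ℕ) (t : ℕ) (ht : t ≤ w.length) :
    ∑ i ∈ Finset.range t, (q :: w).reverse.getD i 0 * U i
      = ∑ i ∈ Finset.range t, w.reverse.getD i 0 * U i := by
  apply Finset.sum_congr rfl
  intro i hi
  have hi' : i < w.reverse.length := by
    have := Finset.mem_range.mp hi
    simp; omega
  rw [List.reverse_cons, List.getD_append _ _ _ _ hi']

theorem valU_cons (U : ℕ → ℕ) (q : ℕ) (w : List ℕ) :
    valU U (q :: w) = q * U w.length + valU U w := by
  unfold valU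
  rw [List.length_cons, Finset.sum_range_succ, sum_cons_aux U q w _ le_rfl, add_comm]
  congr 2
  rw [List.reverse_cons, List.getD_append_right _ _ _ _ (by simp)]
  simp

theorem digit_lt (U : ℕ → ℕ) (hmono : StrictMono U) (h0 : U 0 = 1)
    (hfin : ∃ C, ∀ i, U (i + 1) ≤ C * U i) (q L : ℕ) (h : q * U L < U (L + 1)) :
    q < CU U := by
  have hpos : ∀ i, 0 < U i := fun i => by
    have := hmono.monotone (Nat.zero_le i); omega
  obtain ⟨C, hC⟩ := hfin
  have hle : (U (L + 1) + U L - 1) / U L ≤ CU U := by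
    apply le_csSup
    · refine ⟨C + 1, ?_⟩
      rintro c ⟨i, rfl⟩
      apply Nat.div_le_of_le_mul
      have := hC i
      have h2 := hpos i
      have : U i * (C + 1) = C * U i + U i := by ring
      omega
    · exact ⟨L, rfl⟩
  have : q + 1 ≤ (U (L + 1) + U L - 1) / U L := by
    rw [Nat.le_div_iff_mul_le (hpos L), add_mul]
    omega
  omega

theorem greedy_cons (U : ℕ → ℕ) (hmono : StrictMono U) (h0 : U 0 = 1)
    (hfin : ∃ C, ∀ i, U (i + 1) ≤ C * U i) (q : ℕ) (w : List ℕ) (hw : GreedyWord U w)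
    (h : q * U w.length + valU U w < U (w.length + 1)) : GreedyWord U (q :: w) := by
  obtain ⟨h1, h2, h3⟩ := hw
  have hv : valU U (q :: w) < U (q :: w).length := by rw [valU_cons]; exact h
  refine ⟨?_, hv, ?_⟩
  · intro d hd
    rcases List.mem_cons.mp hd with rfl | hd
    · exact digit_lt U hmono h0 hfin _ w.length (by omega)
    · exact h1 d hd
  · intro t ht
    rcases Nat.lt_or_ge t w.length with h' | h'
    · rw [sum_cons_aux U q w _ h']; exact h3 t h'
    · have : t = w.length := by simp at ht; omega
      subst this
      exact hv

theorem exists_word (U : ℕ → ℕ) (hmono : StrictMono U) (h0 : U 0 = 1)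
    (hfin : ∃ C, ∀ i, U (i + 1) ≤ C * U i) (K : ℕ) :
    ∀ n < U K, ∃ w, w.length = K ∧ GreedyWord U w ∧ valU U w = n := by
  have hpos : ∀ i, 0 < U i := fun i => by
    have := hmono.monotone (Nat.zero_le i); omega
  induction K with
  | zero =>
    intro n hn
    refine ⟨[], rfl, ⟨by simp, by simp [valU, h0], by simp⟩, ?_⟩
    simp [valU]; omega
  | succ K ih =>
    intro n hn
    obtain ⟨w, hl, hg, hv⟩ := ih (n % U K) (Nat.mod_lt _ (hpos K))
    have he : n / U K * U w.length + valU U w = n := by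
      rw [hl, hv]; exact Nat.div_add_mod' n (U K)
    refine ⟨n / U K :: w, by simp [hl], greedy_cons U hmono h0 hfin _ _ hg ?_, ?_⟩
    · rw [he, hl]; exact hn
    · rw [valU_cons, he]

theorem greedy_zeros (U : ℕ → ℕ) (hmono : StrictMono U) (h0 : U 0 = 1)
    (hfin : ∃ C, ∀ i, U (i + 1) ≤ C * U i) (w : List ℕ) (hw : GreedyWord U w) (k : ℕ) :
    GreedyWord U (List.replicate k 0 ++ w) ∧ valU U (List.replicate k 0 ++ w) = valU U w := by
  induction k with
  | zero => simpa using hw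
  | succ k ih =>
    rw [List.replicate_succ, List.cons_append]
    refine ⟨greedy_cons U hmono h0 hfin _ _ ih.1 ?_, ?_⟩
    · have := ih.1.2.1
      have := hmono (Nat.lt_succ_self (List.replicate k 0 ++ w).length)
      simp only [Nat.succ_eq_add_one] at this
      omega
    · rw [valU_cons, ih.2]; simp

theorem mem_rep (U : ℕ → ℕ) (hmono : StrictMono U) (h0 : U 0 = 1)
    (hfin : ∃ C, ∀ i, U (i + 1) ≤ C * U i) (X : Set ℕ) (w : List ℕ) (hw : GreedyWord U w)
    (i : ℕ) (hi : w.length ≤ i) (hgap : U i + valU U w < U (i + 1)) :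
    (1 :: List.replicate (i - w.length) 0) ++ w ∈ repLang U X ↔ U i + valU U w ∈ X := by
  obtain ⟨hg, hv⟩ := greedy_zeros U hmono h0 hfin w hw (i - w.length)
  have hl : (List.replicate (i - w.length) 0 ++ w).length = i := by simp; omega
  rw [List.cons_append]
  have hval : valU U (1 :: (List.replicate (i - w.length) 0 ++ w)) = U i + valU U w := by
    rw [valU_cons, hl, hv, one_mul]
  have hg' := greedy_cons U hmono h0 hfin 1 _ hg (by rw [hl, hv, one_mul]; exact hgap)
  constructor
  · rintro ⟨n, hn, hr⟩
    rw [← hval, hr.1]; exact hn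
  · intro h
    exact ⟨_, h, hval, hg'.1, by simp, hg'.2.2⟩

theorem period_mul (X : Set ℕ) (a p : ℕ) (h : IsPeriodPair X a p) (k n : ℕ) (hn : a ≤ n) :
    n ∈ X ↔ n + p * k ∈ X := by
  induction k with
  | zero => simp
  | succ k ih =>
    rw [ih, h.2 _ (by omega : a ≤ n + p * k)]
    rw [mul_add, mul_one, add_assoc]

theorem dvd_of_shift (X : Set ℕ) (a : ℕ) (h : IsPeriodPair X a (minPeriod X)) (x e : ℕ)
    (hx : a ≤ x) (hs : ∀ n < minPeriod X, (x + n ∈ X ↔ x + e + n ∈ X)) :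
    minPeriod X ∣ e := by
  by_contra hnd
  have hp := h.1
  set p := minPeriod X with hpdef
  have hr : 0 < e % p := Nat.pos_of_ne_zero fun h' => hnd (Nat.dvd_of_mod_eq_zero h')
  have hlt : e % p < p := Nat.mod_lt _ hp
  have hper : IsPeriodPair X x (e % p) := by
    refine ⟨hr, fun n hn => ?_⟩
    have e1 : n = x + (n - x) % p + p * ((n - x) / p) := by
      have := Nat.mod_add_div (n - x) p; omega
    have e2 : n + e % p + p * (e / p) = x + e + (n - x) % p + p * ((n - x) / p) := by
      have := Nat.mod_add_div e p; omega
    rw [period_mul X a p h (e / p) (n + e % p) (by omega), e2,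
      ← period_mul X a p h _ _ (by omega), ← hs _ (Nat.mod_lt _ hp),
      period_mul X a p h ((n - x) / p) (x + (n - x) % p) (by omega), ← e1]
  have : minPeriod X ≤ e % p := Nat.sInf_le ⟨x, hper⟩
  omega

/-- Let `U` be a positional numeration system with
`lim_{i→∞} (U_{i+1} - U_i) = +∞` and `lim_{m→∞} N_U(m) = +∞`.  Then the
minimal period of any ultimately periodic set `X ⊆ ℕ` such that `rep_U(X)` is
accepted by a deterministic finite automaton with `d` states is bounded by the
smallest integer `s₀` such that `N_U(m) > d` for all `m ≥ s₀`. -/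
theorem statement_3 (U : ℕ → ℕ) (hmono : StrictMono U) (h0 : U 0 = 1)
    (hfin : ∃ C, ∀ i, U (i + 1) ≤ C * U i)
    (hlim : Tendsto (fun i => U (i + 1) - U i) atTop atTop)
    (hN : Tendsto (fun m => Ninf U m) atTop atTop)
    (X : Set ℕ) (hX : UltPeriodic X)
    (σ : Type*) [Fintype σ] (d : ℕ) (hd : Fintype.card σ = d)
    (M : DFA ℕ σ) (hM : M.accepts = repLang U X) :
    minPeriod X ≤ sInf {s : ℕ | ∀ m, s ≤ m → d < Ninf U m} := by
  have hne : {s : ℕ | ∀ m, s ≤ m → d < Ninf U m}.Nonempty := by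
    obtain ⟨s, hs⟩ := eventually_atTop.mp (hN.eventually_gt_atTop d)
    exact ⟨s, hs⟩
  have hs0 := Nat.sInf_mem hne
  by_contra hcon
  have hpN : d < Ninf U (minPeriod X) := hs0 _ (by omega)
  have hXp : ∃ a, IsPeriodPair X a (minPeriod X) := by
    obtain ⟨a, p, h⟩ := hX
    exact Nat.sInf_mem (s := {p | ∃ a, IsPeriodPair X a p}) ⟨p, a, h⟩
  obtain ⟨a, ha⟩ := hXp
  have hp := ha.1
  set p := minPeriod X with hpdef
  haveI : NeZero p := ⟨by omega⟩
  have hid : ∀ i, i ≤ U i := fun _ => hmono.le_apply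
  obtain ⟨B, hB⟩ := eventually_atTop.mp (hlim.eventually_ge_atTop (p + 1))
  let T : Set (ZMod p) := {r : ZMod p | ∀ N : ℕ, ∃ i, N ≤ i ∧ (U i : ZMod p) = r}
  have hT : Fintype.card σ < Nat.card T := by rw [hd]; exact hpN
  have hch : ∀ r : T, ∃ i, max p (max a B) ≤ i ∧ (U i : ZMod p) = r := fun r => r.2 _
  choose f hf1 hf2 using hch
  letI : Fintype T := Fintype.ofFinite T
  rw [Nat.card_eq_fintype_card] at hT
  obtain ⟨r, s, hrs, heq⟩ := Fintype.exists_ne_map_eq_of_card_lt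
    (fun r : T => M.eval (1 :: List.replicate (f r - p) 0)) hT
  have key : ∀ n < p, (U (f r) + n ∈ X ↔ U (f s) + n ∈ X) := by
    intro n hn
    obtain ⟨w, hwl, hwg, hwv⟩ := exists_word U hmono h0 hfin p n (by have := hid p; omega)
    have hmem : ∀ t : T, (U (f t) + n ∈ X ↔
        M.evalFrom (M.eval (1 :: List.replicate (f t - p) 0)) w ∈ M.accept) := by
      intro t
      have h1 := hf1 t
      have h2 := hB (f t) (by omega)
      rw [← hwv, ← mem_rep U hmono h0 hfin X w hwg (f t) (by omega) (by omega), hwl, ← hM,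
        DFA.mem_accepts, DFA.eval, DFA.evalFrom_of_append]
    have heq' : M.eval (1 :: List.replicate (f r - p) 0)
      = M.eval (1 :: List.replicate (f s - p) 0) := heq
    rw [hmem r, hmem s, heq']
  have main : ∀ r s : T, U (f r) ≤ U (f s) →
      (∀ n < p, (U (f r) + n ∈ X ↔ U (f s) + n ∈ X)) → r = s := by
    intro r s hle hk
    have h1 := hf1 r
    have h2 := hid (f r)
    have hdvd := dvd_of_shift X a ha (U (f r)) (U (f s) - U (f r)) (by omega) (by
      intro n hn
      rw [Nat.add_sub_cancel' hle]
      exact hk n hn)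
    apply Subtype.ext
    rw [← hf2 r, ← hf2 s]
    rw [ZMod.natCast_eq_natCast_iff]
    exact (Nat.modEq_iff_dvd' hle).mpr hdvd
  rcases le_total (U (f r)) (U (f s)) with h | h
  · exact hrs (main r s h key)
  · exact hrs (main s r h (fun n hn => (key n hn).symm)).symm
end

section
/- Let U = (U_i)_{i≥0} be a linear numeration system such that ℕ is U-recognizable (i.e., the language rep_U(ℕ) of all greedy U-representations is regular). Then every ultimately periodic set X ⊆ ℕ is U-recognizable, i.e., rep_U(X) is a regular language. -/
open Filter

/-- Value of a word with the least significant digit first, positions starting at `j`. -/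
def rval (U : ℕ → ℕ) : ℕ → List ℕ → ℕ
  | _, [] => 0
  | j, d :: y => d * U j + rval U (j + 1) y

theorem rval_eq_sum (U : ℕ → ℕ) (y : List ℕ) : ∀ j,
    rval U j y = ∑ i ∈ Finset.range y.length, y.getD i 0 * U (j + i) := by
  induction y with
  | nil => intro j; simp [rval]
  | cons d y ih =>
    intro j
    rw [rval, ih, List.length_cons, Finset.sum_range_succ']
    simp only [List.getD_cons_succ, List.getD_cons_zero, Nat.add_zero]
    rw [Nat.add_comm]
    congr 1
    apply Finset.sum_congr rfl
    intro i _
    rw [show j + 1 + i = j + (i + 1) by omega]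

theorem valU_eq_rval (U : ℕ → ℕ) (w : List ℕ) : valU U w = rval U 0 w.reverse := by
  rw [rval_eq_sum, valU]
  simp

theorem rval_append (U : ℕ → ℕ) (x y : List ℕ) : ∀ j,
    rval U j (x ++ y) = rval U j x + rval U (j + x.length) y := by
  induction x with
  | nil => intro j; simp [rval]
  | cons d x ih =>
    intro j
    simp only [List.cons_append, rval, ih, List.length_cons]
    rw [show j + 1 + x.length = j + (x.length + 1) by omega]
    omega

/-- The congruence on `ℕ` with threshold `a` and period `p`. -/
def Cong (a p n m : ℕ) : Prop := n ≡ m [MOD p] ∧ (n = m ∨ (a ≤ n ∧ a ≤ m))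

theorem Cong.rfl' {a p n : ℕ} : Cong a p n n := ⟨Nat.ModEq.refl _, Or.inl rfl⟩

theorem Cong.add {a p n m n' m' : ℕ} (h : Cong a p n m) (h' : Cong a p n' m') :
    Cong a p (n + n') (m + m') := by
  refine ⟨h.1.add h'.1, ?_⟩
  have := h.2
  have := h'.2
  omega

theorem Cong.mul {a p n m : ℕ} (d : ℕ) (h : Cong a p n m) : Cong a p (d * n) (d * m) := by
  refine ⟨h.1.mul_left d, ?_⟩
  rcases Nat.eq_zero_or_pos d with rfl | hd
  · left; simp
  · rcases h.2 with rfl | ⟨h1, h2⟩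
    · left; rfl
    · right
      exact ⟨h1.trans (Nat.le_mul_of_pos_left _ hd), h2.trans (Nat.le_mul_of_pos_left _ hd)⟩

/-- The normal form. -/
def nf (a p n : ℕ) : ℕ := if n < a then n else a + (n - a) % p

theorem nf_lt {a p : ℕ} (hp : 0 < p) (n : ℕ) : nf a p n < a + p := by
  unfold nf
  have := Nat.mod_lt (n - a) hp
  split_ifs <;> omega

theorem nf_spec (a p n : ℕ) : nf a p n = n ∨ (a ≤ nf a p n ∧ ∃ c, n = nf a p n + c * p) := by
  unfold nf
  split_ifs with h
  · left; rfl
  · right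
    refine ⟨by omega, (n - a) / p, ?_⟩
    have := Nat.mod_add_div (n - a) p
    rw [Nat.mul_comm] at this
    omega

theorem cong_nf (a p n : ℕ) : Cong a p n (nf a p n) := by
  rcases nf_spec a p n with h | ⟨h, c, hc⟩
  · rw [h]; exact Cong.rfl'
  · constructor
    · conv_lhs => rw [hc]
      simp [Nat.ModEq]
    · right
      exact ⟨by omega, h⟩

theorem period_mul_s8 {α : Type*} {f : ℕ → α} {N q : ℕ} (h : ∀ n, N ≤ n → f (n + q) = f n) (c : ℕ) :
    ∀ n, N ≤ n → f (n + c * q) = f n := by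
  induction c with
  | zero => intro n _; simp
  | succ c ih =>
    intro n hn
    rw [Nat.succ_mul, ← Nat.add_assoc, h _ (by omega), ih n hn]

theorem mem_of_le {X : Set ℕ} {a p : ℕ} (hX : IsPeriodPair X a p) {n m : ℕ} (hn : a ≤ n)
    (hnm : n ≤ m) (h : n ≡ m [MOD p]) : n ∈ X ↔ m ∈ X := by
  obtain ⟨c, hc⟩ := (Nat.modEq_iff_dvd' hnm).1 h
  have hm : m = n + c * p := by rw [Nat.mul_comm]; omega
  have := period_mul_s8 (f := fun n => n ∈ X) (fun n hn => propext (hX.2 n hn).symm) c n hn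
  rw [hm]
  exact (iff_of_eq this).symm

theorem Cong.mem {X : Set ℕ} {a p n m : ℕ} (hX : IsPeriodPair X a p) (h : Cong a p n m) :
    n ∈ X ↔ m ∈ X := by
  rcases h with ⟨h, rfl | ⟨h1, h2⟩⟩
  · rfl
  · rcases le_total n m with hl | hl
    · exact mem_of_le hX h1 hl h
    · exact (mem_of_le hX h2 hl h.symm).symm

theorem cong_rval {U : ℕ → ℕ} {a p : ℕ} (y : List ℕ) : ∀ i j,
    (∀ t, Cong a p (U (i + t)) (U (j + t))) → Cong a p (rval U i y) (rval U j y) := by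
  induction y with
  | nil => intro i j _; exact Cong.rfl'
  | cons d y ih =>
    intro i j h
    refine (Cong.mul d (h 0)).add (ih _ _ fun t => ?_)
    have := h (t + 1)
    rwa [show i + (t + 1) = i + 1 + t by omega, show j + (t + 1) = j + 1 + t by omega] at this

theorem ev_periodic (U : ℕ → ℕ) (k : ℕ) (hk : 0 < k) (co : Fin k → ℤ)
    (hrec : ∀ i : ℕ, (U (i + k) : ℤ) = ∑ j : Fin k, co j * U (i + k - 1 - (j : ℕ)))
    (p : ℕ) (hp : 0 < p) :
    ∃ N q, 0 < q ∧ ∀ n, N ≤ n → (U (n + q) : ZMod p) = (U n : ZMod p) := by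
  haveI : NeZero p := ⟨hp.ne'⟩
  obtain ⟨i, i', hne, heq⟩ := Finite.exists_ne_map_eq_of_infinite
    (fun i : ℕ => fun j : Fin k => (U (i + j) : ZMod p))
  wlog hlt : i < i' generalizing i i'
  · exact this i' i hne.symm heq.symm (by omega)
  have key : ∀ t, (U (i + t) : ZMod p) = U (i' + t) := by
    intro t
    induction t using Nat.strong_induction_on with
    | _ t ih =>
      by_cases ht : t < k
      · exact congrFun heq ⟨t, ht⟩
      · have hr : ∀ i : ℕ, (U (i + k) : ZMod p) =
            ∑ j : Fin k, (co j : ZMod p) * U (i + k - 1 - (j : ℕ)) := by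
          intro i
          have := congrArg (Int.cast : ℤ → ZMod p) (hrec i)
          push_cast at this
          exact this
        have e1 := hr (i + (t - k))
        have e2 := hr (i' + (t - k))
        rw [show i + (t - k) + k = i + t by omega] at e1
        rw [show i' + (t - k) + k = i' + t by omega] at e2
        rw [e1, e2]
        apply Finset.sum_congr rfl
        intro j _
        have := ih (t - 1 - j) (by omega)
        have hj := j.2
        rw [show i + t - 1 - (j : ℕ) = i + (t - 1 - j) by omega,
          show i' + t - 1 - (j : ℕ) = i' + (t - 1 - j) by omega, this]
  refine ⟨i, i' - i, by omega, fun n hn => ?_⟩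
  have := key (n - i)
  rw [show i + (n - i) = n by omega, show i' + (n - i) = n + (i' - i) by omega] at this
  exact this.symm

theorem regular_val (U : ℕ → ℕ) (hmono : StrictMono U) (k : ℕ) (hk : 0 < k) (co : Fin k → ℤ)
    (hrec : ∀ i : ℕ, (U (i + k) : ℤ) = ∑ j : Fin k, co j * U (i + k - 1 - (j : ℕ)))
    (X : Set ℕ) (a p : ℕ) (hX : IsPeriodPair X a p) :
    Language.IsRegular ({w | rval U 0 w ∈ X} : Language ℕ) := by
  obtain ⟨N, q, hq, hper⟩ := ev_periodic U k hk co hrec p hX.1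
  have hidx : ∀ n t, Cong a p (U (n + t)) (U (nf (N + a) q n + t)) := by
    intro n t
    rcases nf_spec (N + a) q n with h | ⟨h, c, hc⟩
    · rw [h]; exact Cong.rfl'
    · have h1 := period_mul_s8 (f := fun n => (U n : ZMod p)) hper c (nf (N + a) q n + t) (by omega)
      have h2 : nf (N + a) q n + t + c * q = n + t := by omega
      simp only [h2] at h1
      refine ⟨(ZMod.natCast_eq_natCast_iff _ _ _).1 h1, Or.inr ⟨?_, ?_⟩⟩
      · have := hmono.le_apply (x := n + t)
        omega
      · have := hmono.le_apply (x := nf (N + a) q n + t)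
        omega
  apply Language.IsRegular.of_finite_range_leftQuotient
  let F : ℕ × ℕ → Language ℕ := fun z => {y | z.1 + rval U z.2 y ∈ X}
  refine (((Set.finite_Iio (a + p)).prod (Set.finite_Iio (N + a + q))).image F).subset ?_
  rintro _ ⟨x, rfl⟩
  refine ⟨(nf a p (rval U 0 x), nf (N + a) q x.length), ⟨nf_lt hX.1 _, nf_lt hq _⟩, ?_⟩
  ext y
  change nf a p (rval U 0 x) + rval U (nf (N + a) q x.length) y ∈ X ↔ rval U 0 (x ++ y) ∈ X
  rw [rval_append, Nat.zero_add]
  exact (Cong.mem hX ((cong_nf a p _).add (cong_rval y _ _ (hidx x.length)))).symm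

/-- Let `U` be a linear numeration system such that `ℕ` is `U`-recognizable
(the language `rep_U(ℕ)` of all greedy `U`-representations is regular).  Then
every ultimately periodic set `X ⊆ ℕ` is `U`-recognizable, i.e. `rep_U(X)` is a
regular language. -/
theorem statement_8 (U : ℕ → ℕ) (hmono : StrictMono U) (h0 : U 0 = 1)
    (hfin : ∃ C, ∀ i, U (i + 1) ≤ C * U i)
    (k : ℕ) (hk : 0 < k) (co : Fin k → ℤ)
    (hak : co ⟨k - 1, Nat.sub_lt hk Nat.one_pos⟩ ≠ 0)
    (hrec : ∀ i : ℕ, (U (i + k) : ℤ) = ∑ j : Fin k, co j * U (i + k - 1 - (j : ℕ)))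
    (hNrec : Language.IsRegular (repLang U Set.univ))
    (X : Set ℕ) (hX : UltPeriodic X) :
    Language.IsRegular (repLang U X) := by
  obtain ⟨a, p, hX⟩ := hX
  have hreg := (regular_val U hmono k hk co hrec X a p hX).reverse
  have h := hNrec.inf hreg
  convert h using 1
  ext w
  constructor
  · rintro ⟨n, hn, hw⟩
    refine ⟨⟨n, trivial, hw⟩, ?_⟩
    change rval U 0 w.reverse ∈ X
    rw [← valU_eq_rval, hw.1]
    exact hn
  · rintro ⟨⟨n, _, hw⟩, hv⟩
    change rval U 0 w.reverse ∈ X at hv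
    rw [← valU_eq_rval, hw.1] at hv
    exact ⟨n, hv, hw⟩
end
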